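/- For every R > 0 there exists ε > 0 such that the following holds for every N ≥ 1. Let Γ, H : ℝ^N → (ℝ^N × ℝ^N → ℝ^N) be maps assigning to each z ∈ ℝ^N bilinear maps Γ(z) and H(z), with sup_z ‖Γ(z)‖ ≤ R, sup_z ‖H(z)‖ ≤ R (operator norms of bilinear maps), and Lipschitz in z: ‖Γ(z) − Γ(z')‖ ≤ R‖z − z'‖ and ‖H(z) − H(z')‖ ≤ R‖z − z'‖ for all z, z'. Let u, v : ℝ² → ℝ^N be smooth on the closed unit disk, satisfy for every x in the open unit disk B(0,1): Δu(x) = −Γ(u(x))(∂₁u(x), ∂₁u(x)) − Γ(u(x))(∂₂u(x), ∂₂u(x)) − H(u(x))(∂₁u(x), ∂₂u(x)), and the same equation for v; suppose u(x) = v(x) for every x with ‖x‖ = 1, and ‖∇u(x)‖ ≤ ε, ‖∇v(x)‖ ≤ ε for all x in the closed unit disk. Then u = v on the closed unit disk. -/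

import Mathlib

open MeasureTheory

/-- The componentwise Laplacian of a map `u : ℝ² → ℝ^N`. -/
noncomputable def lapV (N : ℕ) (u : EuclideanSpace ℝ (Fin 2) → EuclideanSpace ℝ (Fin N))
    (x : EuclideanSpace ℝ (Fin 2)) : EuclideanSpace ℝ (Fin N) :=
  ∑ a : Fin 2,
    fderiv ℝ (fun y => fderiv ℝ u y (EuclideanSpace.single a 1)) x (EuclideanSpace.single a 1)

/-- The partial derivative `∂ₐu(x)` of a map `u : ℝ² → ℝ^N`. -/
noncomputable def pdV (N : ℕ) (a : Fin 2)
    (u : EuclideanSpace ℝ (Fin 2) → EuclideanSpace ℝ (Fin N))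
    (x : EuclideanSpace ℝ (Fin 2)) : EuclideanSpace ℝ (Fin N) :=
  fderiv ℝ u x (EuclideanSpace.single a 1)

lemma aux_second (h h' : ℝ → ℝ) (c : ℝ) (hd : ∀ᶠ t in nhds (0:ℝ), HasDerivAt h (h' t) t)
    (h2 : HasDerivAt h' c 0) (hmax : IsLocalMax h 0) : c ≤ 0 := by
  by_contra! hc
  have e1 : deriv h =ᶠ[nhds 0] h' := hd.mono fun t ht => ht.deriv
  have e2 : deriv (deriv h) 0 = c := by rw [e1.deriv_eq, h2.deriv]
  have hmin : IsLocalMin h 0 := isLocalMin_of_deriv_deriv_pos (by rw [e2]; exact hc)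
    hmax.deriv_eq_zero hd.self_of_nhds.continuousAt
  have hconst : h =ᶠ[nhds 0] fun _ => h 0 := by
    filter_upwards [hmin, hmax] with t h1 h2 using le_antisymm h2 h1
  have e3 : deriv h =ᶠ[nhds 0] deriv (fun _ => h 0) := hconst.deriv
  have e4 : deriv (deriv h) 0 = 0 := by rw [e3.deriv_eq]; simp
  linarith

lemma aux_dir {N : ℕ} (w : EuclideanSpace ℝ (Fin 2) → EuclideanSpace ℝ (Fin N))
    (x e : EuclideanSpace ℝ (Fin 2)) (he : ‖e‖ = 1) (M : ℝ) (hw : ContDiffAt ℝ 2 w x)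
    (hmax : IsLocalMax (fun y => ‖w y‖ ^ 2 - M * (2 - ‖y‖ ^ 2)) x) :
    ‖fderiv ℝ w x e‖ ^ 2 + inner ℝ (w x) (fderiv ℝ (fun y => fderiv ℝ w y e) x e) + M ≤ 0 := by
  set l : ℝ → EuclideanSpace ℝ (Fin 2) := fun t => x + t • e with hl
  have l0 : l 0 = x := by simp [hl]
  have hld : ∀ t, HasDerivAt l e t := fun t => by
    exact (((hasDerivAt_id t).smul_const e).const_add x).congr_deriv (one_smul ℝ e)
  have hlc : Filter.Tendsto l (nhds 0) (nhds x) := by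
    have := (hld 0).continuousAt.tendsto
    rwa [l0] at this
  have hev : ∀ᶠ y in nhds x, DifferentiableAt ℝ w y := by
    filter_upwards [hw.eventually (by simp)] with y hy using hy.differentiableAt (by simp)
  have hp : ∀ᶠ t in nhds (0:ℝ), HasDerivAt (fun t => w (l t)) (fderiv ℝ w (l t) e) t := by
    filter_upwards [hlc.eventually hev] with t ht
    exact ht.hasFDerivAt.comp_hasDerivAt t (hld t)
  have hD : DifferentiableAt ℝ (fun y => fderiv ℝ w y e) x := by
    have h1 : DifferentiableAt ℝ (fderiv ℝ w) x :=
      (hw.fderiv_right (m := 1) (by norm_num)).differentiableAt (by simp)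
    exact h1.clm_apply (differentiableAt_const e)
  have hp2 : HasDerivAt (fun t => fderiv ℝ w (l t) e)
      (fderiv ℝ (fun y => fderiv ℝ w y e) x e) 0 := by
    have h1 : HasFDerivAt (fun y => fderiv ℝ w y e) (fderiv ℝ (fun y => fderiv ℝ w y e) x) (l 0) := by
      rw [l0]; exact hD.hasFDerivAt
    exact h1.comp_hasDerivAt 0 (hld 0)
  have key := aux_second (fun t => ‖w (l t)‖ ^ 2 - M * (2 - ‖l t‖ ^ 2))
    (fun t => 2 * inner ℝ (w (l t)) (fderiv ℝ w (l t) e) + M * (2 * inner ℝ (l t) e))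
    (2 * (inner ℝ (w (l 0)) (fderiv ℝ (fun y => fderiv ℝ w y e) x e)
      + inner ℝ (fderiv ℝ w (l 0) e) (fderiv ℝ w (l 0) e)) + M * (2 * inner ℝ e e)) ?_ ?_ ?_
  · rw [l0, real_inner_self_eq_norm_sq, real_inner_self_eq_norm_sq, he] at key
    linarith
  · filter_upwards [hp] with t ht
    have := ht.norm_sq.sub (((hld t).norm_sq.const_sub 2).const_mul M)
    exact this.congr_deriv (by ring)
  · have h1 := (hp.self_of_nhds.inner ℝ hp2).const_mul 2
    have h2 := (((hld 0).inner ℝ (hasDerivAt_const (0:ℝ) e)).const_mul 2).const_mul M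
    exact (h1.add h2).congr_deriv (by simp)
  · have := hlc.eventually hmax
    filter_upwards [this] with t ht
    simpa [l0] using ht

lemma aux_bil {N : ℕ} (A B : EuclideanSpace ℝ (Fin N) →L[ℝ] EuclideanSpace ℝ (Fin N) →L[ℝ]
      EuclideanSpace ℝ (Fin N)) (a a' b b' : EuclideanSpace ℝ (Fin N)) (R ε W : ℝ) (hR : 0 ≤ R)
    (hW : 0 ≤ W)
    (hB : ‖B‖ ≤ R) (hAB : ‖A - B‖ ≤ R * W) (ha : ‖a‖ ≤ ε) (ha' : ‖a'‖ ≤ ε)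
    (hb : ‖b‖ ≤ ε) :
    ‖A a a' - B b b'‖ ≤ R * W * ε ^ 2 + R * ε * ‖a - b‖ + R * ε * ‖a' - b'‖ := by
  have hε : 0 ≤ ε := (norm_nonneg _).trans ha
  have e : A a a' - B b b' = (A - B) a a' + B (a - b) a' + B b (a' - b') := by
    simp only [sub_apply, map_sub]; abel
  rw [e]
  refine (norm_add₃_le).trans ?_
  have h1 : ‖(A - B) a a'‖ ≤ R * W * ε * ε := ((A - B).le_opNorm₂ a a').trans (by gcongr)
  have h2 : ‖B (a - b) a'‖ ≤ R * ‖a - b‖ * ε := (B.le_opNorm₂ _ _).trans (by gcongr)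
  have h3 : ‖B b (a' - b')‖ ≤ R * ε * ‖a' - b'‖ := (B.le_opNorm₂ _ _).trans (by gcongr)
  linarith

theorem stmt13 (R : ℝ) (hR : 0 < R) :
    ∃ ε : ℝ, 0 < ε ∧
    ∀ N : ℕ, 1 ≤ N →
    ∀ Γ Hc : EuclideanSpace ℝ (Fin N) →
        (EuclideanSpace ℝ (Fin N) →L[ℝ] EuclideanSpace ℝ (Fin N) →L[ℝ] EuclideanSpace ℝ (Fin N)),
      (∀ z, ‖Γ z‖ ≤ R) → (∀ z, ‖Hc z‖ ≤ R) →
      (∀ z z', ‖Γ z - Γ z'‖ ≤ R * ‖z - z'‖) → (∀ z z', ‖Hc z - Hc z'‖ ≤ R * ‖z - z'‖) →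
    ∀ u v : EuclideanSpace ℝ (Fin 2) → EuclideanSpace ℝ (Fin N),
      (∀ n : ℕ, ContDiffOn ℝ n u (Metric.closedBall (0 : EuclideanSpace ℝ (Fin 2)) 1)) →
      (∀ n : ℕ, ContDiffOn ℝ n v (Metric.closedBall (0 : EuclideanSpace ℝ (Fin 2)) 1)) →
      (∀ x ∈ Metric.ball (0 : EuclideanSpace ℝ (Fin 2)) 1,
        lapV N u x = - Γ (u x) (pdV N 0 u x) (pdV N 0 u x)
          - Γ (u x) (pdV N 1 u x) (pdV N 1 u x)
          - Hc (u x) (pdV N 0 u x) (pdV N 1 u x)) →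
      (∀ x ∈ Metric.ball (0 : EuclideanSpace ℝ (Fin 2)) 1,
        lapV N v x = - Γ (v x) (pdV N 0 v x) (pdV N 0 v x)
          - Γ (v x) (pdV N 1 v x) (pdV N 1 v x)
          - Hc (v x) (pdV N 0 v x) (pdV N 1 v x)) →
      (∀ x : EuclideanSpace ℝ (Fin 2), ‖x‖ = 1 → u x = v x) →
      (∀ x ∈ Metric.closedBall (0 : EuclideanSpace ℝ (Fin 2)) 1, ‖fderiv ℝ u x‖ ≤ ε) →
      (∀ x ∈ Metric.closedBall (0 : EuclideanSpace ℝ (Fin 2)) 1, ‖fderiv ℝ v x‖ ≤ ε) →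
      ∀ x ∈ Metric.closedBall (0 : EuclideanSpace ℝ (Fin 2)) 1, u x = v x := by
  refine ⟨1 / (2 + 3 * R), by positivity, ?_⟩
  intro N _ Γ Hc hΓ hH hΓL hHL u v hu hv hue hve hbd hud hvd
  set ε := 1 / (2 + 3 * R) with hεd
  have hε : 0 < ε := by positivity
  have hφ : ∀ x ∈ Metric.closedBall (0 : EuclideanSpace ℝ (Fin 2)) 1, 0 < 2 - ‖x‖ ^ 2 := by
    intro x hx
    have : ‖x‖ ≤ 1 := by simpa using hx
    nlinarith [norm_nonneg x]
  have hcont : ContinuousOn (fun x => ‖u x - v x‖ ^ 2 / (2 - ‖x‖ ^ 2))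
      (Metric.closedBall (0 : EuclideanSpace ℝ (Fin 2)) 1) := by
    refine ContinuousOn.div (((hu 0).continuousOn.sub (hv 0).continuousOn).norm.pow 2)
      (by fun_prop) (fun x hx => (hφ x hx).ne')
  obtain ⟨x0, hx0, hmax⟩ := (isCompact_closedBall (0 : EuclideanSpace ℝ (Fin 2)) 1).exists_isMaxOn
    ⟨0, by simp⟩ hcont
  set M := ‖u x0 - v x0‖ ^ 2 / (2 - ‖x0‖ ^ 2) with hM
  have hle : ∀ x ∈ Metric.closedBall (0 : EuclideanSpace ℝ (Fin 2)) 1,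
      ‖u x - v x‖ ^ 2 ≤ M * (2 - ‖x‖ ^ 2) := fun x hx => (div_le_iff₀ (hφ x hx)).1 (hmax hx)
  have heq : ‖u x0 - v x0‖ ^ 2 = M * (2 - ‖x0‖ ^ 2) := by
    rw [hM, div_mul_cancel₀ _ (hφ x0 hx0).ne']
  have hM0 : 0 ≤ M := div_nonneg (by positivity) (hφ x0 hx0).le
  suffices hMz : M ≤ 0 by
    intro x hx
    have h1 := hle x hx
    have h2 : ‖u x - v x‖ ^ 2 ≤ 0 := h1.trans (mul_nonpos_of_nonpos_of_nonneg hMz (hφ x hx).le)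
    have h3 : ‖u x - v x‖ = 0 := by
      have := sq_nonneg ‖u x - v x‖
      exact pow_eq_zero_iff (two_ne_zero) |>.1 (le_antisymm h2 this)
    exact sub_eq_zero.1 (norm_eq_zero.1 h3)
  by_contra! hMp
  have hx0b : x0 ∈ Metric.ball (0 : EuclideanSpace ℝ (Fin 2)) 1 := by
    have h1 : ‖x0‖ ≤ 1 := by simpa using hx0
    rcases h1.lt_or_eq with h | h
    · simpa using h
    · exfalso
      rw [hbd x0 h, h] at heq
      norm_num at heq
      linarith
  have hnh : Metric.closedBall (0 : EuclideanSpace ℝ (Fin 2)) 1 ∈ nhds x0 :=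
    Filter.mem_of_superset (Metric.isOpen_ball.mem_nhds hx0b) Metric.ball_subset_closedBall
  have huc : ContDiffAt ℝ 2 u x0 := (hu 2).contDiffAt hnh
  have hvc : ContDiffAt ℝ 2 v x0 := (hv 2).contDiffAt hnh
  have hlm : IsLocalMax (fun y => ‖(fun z => u z - v z) y‖ ^ 2 - M * (2 - ‖y‖ ^ 2)) x0 := by
    filter_upwards [hnh] with y hy
    have := hle y hy
    show ‖u y - v y‖ ^ 2 - M * (2 - ‖y‖ ^ 2) ≤ ‖u x0 - v x0‖ ^ 2 - M * (2 - ‖x0‖ ^ 2)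
    linarith
  have hfd : ∀ e : EuclideanSpace ℝ (Fin 2), (fun y => fderiv ℝ (fun z => u z - v z) y e)
      =ᶠ[nhds x0] fun y => fderiv ℝ u y e - fderiv ℝ v y e := by
    intro e
    filter_upwards [huc.eventually (by simp), hvc.eventually (by simp)] with y h1 h2
    rw [fderiv_fun_sub (h1.differentiableAt (by simp)) (h2.differentiableAt (by simp))]
    rfl
  have hdd : ∀ (f : EuclideanSpace ℝ (Fin 2) → EuclideanSpace ℝ (Fin N)), ContDiffAt ℝ 2 f x0 →
      ∀ e, DifferentiableAt ℝ (fun y => fderiv ℝ f y e) x0 := by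
    intro f hf e
    have h1 : DifferentiableAt ℝ (fderiv ℝ f) x0 :=
      (hf.fderiv_right (m := 1) (by norm_num)).differentiableAt (by simp)
    exact h1.clm_apply (differentiableAt_const e)
  have hdir : ∀ a : Fin 2, ‖pdV N a u x0 - pdV N a v x0‖ ^ 2 + inner ℝ (u x0 - v x0)
      (fderiv ℝ (fun y => fderiv ℝ u y (EuclideanSpace.single a 1)) x0 (EuclideanSpace.single a 1)
      - fderiv ℝ (fun y => fderiv ℝ v y (EuclideanSpace.single a 1)) x0
        (EuclideanSpace.single a 1)) + M ≤ 0 := by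
    intro a
    have h := aux_dir (fun z => u z - v z) x0 (EuclideanSpace.single a 1) (by simp) M
      (huc.sub hvc) hlm
    have h0 : fderiv ℝ (fun z => u z - v z) x0 (EuclideanSpace.single a 1) = _ :=
      (hfd (EuclideanSpace.single a 1)).self_of_nhds
    rw [(hfd _).fderiv_eq, h0,
      fderiv_fun_sub (hdd u huc _) (hdd v hvc _)] at h
    exact h
  have hsum := add_le_add (hdir 0) (hdir 1)
  have hlap : inner ℝ (u x0 - v x0) (lapV N u x0 - lapV N v x0) =
      inner ℝ (u x0 - v x0)
      (fderiv ℝ (fun y => fderiv ℝ u y (EuclideanSpace.single 0 1)) x0 (EuclideanSpace.single 0 1)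
      - fderiv ℝ (fun y => fderiv ℝ v y (EuclideanSpace.single 0 1)) x0
        (EuclideanSpace.single 0 1)) + inner ℝ (u x0 - v x0)
      (fderiv ℝ (fun y => fderiv ℝ u y (EuclideanSpace.single 1 1)) x0 (EuclideanSpace.single 1 1)
      - fderiv ℝ (fun y => fderiv ℝ v y (EuclideanSpace.single 1 1)) x0
        (EuclideanSpace.single 1 1)) := by
    rw [← inner_add_right]
    congr 1
    simp only [lapV, Fin.sum_univ_two]
    abel
  have hpu : ∀ a, ‖pdV N a u x0‖ ≤ ε := fun a => by
    have := (fderiv ℝ u x0).le_of_opNorm_le (hud x0 hx0) (EuclideanSpace.single a 1)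
    simpa [pdV] using this
  have hpv : ∀ a, ‖pdV N a v x0‖ ≤ ε := fun a => by
    have := (fderiv ℝ v x0).le_of_opNorm_le (hvd x0 hx0) (EuclideanSpace.single a 1)
    simpa [pdV] using this
  set W := ‖u x0 - v x0‖ with hW
  have hW0 : 0 ≤ W := norm_nonneg _
  set d0 := ‖pdV N 0 u x0 - pdV N 0 v x0‖ with hd0
  set d1 := ‖pdV N 1 u x0 - pdV N 1 v x0‖ with hd1
  have b1 := aux_bil (Γ (u x0)) (Γ (v x0)) _ _ _ (pdV N 0 v x0) R ε W hR.le hW0 (hΓ _) (hΓL _ _)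
    (hpu 0) (hpu 0) (hpv 0)
  have b2 := aux_bil (Γ (u x0)) (Γ (v x0)) _ _ _ (pdV N 1 v x0) R ε W hR.le hW0 (hΓ _) (hΓL _ _)
    (hpu 1) (hpu 1) (hpv 1)
  have b3 := aux_bil (Hc (u x0)) (Hc (v x0)) _ _ _ (pdV N 1 v x0) R ε W hR.le hW0 (hH _) (hHL _ _)
    (hpu 0) (hpu 1) (hpv 0)
  have hL : ‖lapV N u x0 - lapV N v x0‖ ≤ 3 * R * ε ^ 2 * W + 3 * (R * ε) * (d0 + d1) := by
    rw [hue x0 hx0b, hve x0 hx0b, ← norm_neg]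
    refine le_trans (le_of_eq (congrArg norm ?_)) ((norm_add₃_le).trans
      ((add_le_add (add_le_add b1 b2) b3).trans (le_of_eq ?_)))
    · abel
    · ring
  have hin : -(W * (3 * R * ε ^ 2 * W + 3 * (R * ε) * (d0 + d1))) ≤
      inner ℝ (u x0 - v x0) (lapV N u x0 - lapV N v x0) := by
    have h1 := abs_real_inner_le_norm (u x0 - v x0) (lapV N u x0 - lapV N v x0)
    have h2 := mul_le_mul_of_nonneg_left hL hW0
    have h3 := neg_abs_le (inner ℝ (u x0 - v x0) (lapV N u x0 - lapV N v x0))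
    linarith
  have hW2 : W ^ 2 ≤ 2 * M := by rw [heq]; nlinarith [sq_nonneg ‖x0‖]
  have hK : (3 * R + 9 / 2 * R ^ 2) * ε ^ 2 < 1 := by
    rw [hεd, div_pow, one_pow, mul_one_div, div_lt_one (by positivity)]
    nlinarith
  have hK2 : (3 * R + 9 / 2 * R ^ 2) * ε ^ 2 * W ^ 2 ≤
      (3 * R + 9 / 2 * R ^ 2) * ε ^ 2 * (2 * M) := by gcongr
  have hK3 : (3 * R + 9 / 2 * R ^ 2) * ε ^ 2 * (2 * M) < 1 * (2 * M) := by gcongr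
  have q0 := sq_nonneg (d0 - 3 / 2 * (R * ε) * W)
  have q1 := sq_nonneg (d1 - 3 / 2 * (R * ε) * W)
  nlinarith
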